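/- arXiv:1902.08300 — 4 statements merged into one kernel-verified Lean document; each statement's English description precedes it below -/
import Mathlib

section
/- For every continuous linear functional f on V_h that vanishes on V_N (f(φ) = 0 for all φ ∈ V_N) one has the two-sided localized bound (1/√J)·(Σ_{i=1}^{M̃} ‖f‖_{O_i'}²)^{1/2} ≤ ‖f‖_{V_h'} ≤ c_N·(Σ_{i=1}^{M̃} ‖f‖_{O_i'}²)^{1/2}. -/
open scoped RealInnerProductSpace

/-- **Localized lower and upper bounds for functionals** (Theorem 5.1 of the paper).

`Vh` is a finite-dimensional real Hilbert space, `O i` (`i : Fin M`) are subspaces with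
linear maps `P i : Vh → O i` summing to the identity, the `O i` can be partitioned into
`J` groups (via `grp : Fin M → Fin J`) of pairwise orthogonal subspaces, `VN ⊆ Vh` is a
subspace and `cN ≥ 0` is a stability constant for the decomposition modulo `VN`.
Then for every continuous linear functional `f` vanishing on `VN`:
`(1/√J)·(Σᵢ ‖f‖_{O i'}²)^{1/2} ≤ ‖f‖ ≤ cN·(Σᵢ ‖f‖_{O i'}²)^{1/2}`. -/
theorem localized_bounds_for_functionals
    {Vh : Type*} [NormedAddCommGroup Vh] [InnerProductSpace ℝ Vh]
    [FiniteDimensional ℝ Vh]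
    (M J : ℕ) (O : Fin M → Submodule ℝ Vh)
    (P : Fin M → Vh →ₗ[ℝ] Vh)
    (hrange : ∀ i x, P i x ∈ O i)
    (hsum : ∀ x : Vh, (∑ i, P i x) = x)
    (grp : Fin M → Fin J)
    (horth : ∀ i₁ i₂, i₁ ≠ i₂ → grp i₁ = grp i₂ →
      ∀ x ∈ O i₁, ∀ y ∈ O i₂, ⟪x, y⟫ = 0)
    (VN : Submodule ℝ Vh) (cN : ℝ) (hcN : 0 ≤ cN)
    (hstab : ∀ φ : Vh,
      Real.sqrt (∑ i, (⨅ ψ : (VN ⊓ O i : Submodule ℝ Vh), ‖P i φ - ψ‖) ^ 2) ≤ cN * ‖φ‖)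
    (f : Vh →L[ℝ] ℝ) (hf : ∀ φ ∈ VN, f φ = 0) :
    (1 / Real.sqrt J) * Real.sqrt (∑ i, ‖f.comp (O i).subtypeL‖ ^ 2) ≤ ‖f‖ ∧
    ‖f‖ ≤ cN * Real.sqrt (∑ i, ‖f.comp (O i).subtypeL‖ ^ 2) := by
  constructor
  · have key : ∀ i, ∃ g ∈ O i, ‖g‖ = ‖f.comp (O i).subtypeL‖ ∧
        f g = ‖f.comp (O i).subtypeL‖ ^ 2 := by
      intro i
      set F := f.comp (O i).subtypeL with hF
      let g : O i := (InnerProductSpace.toDual ℝ (O i)).symm F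
      have hg : ‖g‖ = ‖F‖ := LinearIsometryEquiv.norm_map _ _
      refine ⟨g, g.2, hg, ?_⟩
      have h1 : ⟪g, g⟫ = F g := InnerProductSpace.toDual_symm_apply
      rw [real_inner_self_eq_norm_sq, hg] at h1
      rw [h1]
      rfl
    choose g hgO hgn hgf using key
    have hgroup : ∀ j : Fin J, ∑ i with grp i = j, ‖f.comp (O i).subtypeL‖ ^ 2 ≤ ‖f‖ ^ 2 := by
      intro j
      set S := ∑ i with grp i = j, ‖f.comp (O i).subtypeL‖ ^ 2 with hS
      let s : Vh := ∑ i with grp i = j, g i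
      have hfs : f s = S := by
        simp only [s, map_sum, hgf, hS]
      have hs : ‖s‖ ^ 2 = S := by
        rw [← real_inner_self_eq_norm_sq, hS]
        simp only [s]
        rw [sum_inner]
        refine Finset.sum_congr rfl fun a ha => ?_
        rw [inner_sum, Finset.sum_eq_single a]
        · rw [real_inner_self_eq_norm_sq, hgn]
        · intro b hb hba
          rw [Finset.mem_filter] at ha hb
          exact horth a b hba.symm (ha.2.trans hb.2.symm) _ (hgO a) _ (hgO b)
        · intro h
          exact absurd ha h
      have h2 : S ≤ ‖f‖ * ‖s‖ := by
        rw [← hfs]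
        exact (le_abs_self _).trans (f.le_opNorm s)
      nlinarith [sq_nonneg (‖f‖ - ‖s‖)]
    have htot : ∑ i, ‖f.comp (O i).subtypeL‖ ^ 2 ≤ J * ‖f‖ ^ 2 := by
      rw [← Finset.sum_fiberwise Finset.univ grp]
      refine (Finset.sum_le_sum fun j _ => hgroup j).trans ?_
      simp
    have h3 : Real.sqrt (∑ i, ‖f.comp (O i).subtypeL‖ ^ 2) ≤ Real.sqrt J * ‖f‖ := by
      refine (Real.sqrt_le_sqrt htot).trans ?_
      rw [Real.sqrt_mul (Nat.cast_nonneg J), Real.sqrt_sq (norm_nonneg f)]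
    rw [one_div, inv_mul_eq_div]
    exact div_le_of_le_mul₀ (Real.sqrt_nonneg _) (norm_nonneg f) (by rwa [mul_comm] at h3)
  · refine f.opNorm_le_bound (mul_nonneg hcN (Real.sqrt_nonneg _)) fun φ => ?_
    have hloc : ∀ i, |f (P i φ)| ≤ ‖f.comp (O i).subtypeL‖ *
        ⨅ ψ : (VN ⊓ O i : Submodule ℝ Vh), ‖P i φ - ψ‖ := by
      intro i
      rw [Real.mul_iInf_of_nonneg (norm_nonneg (f.comp (O i).subtypeL))]
      refine le_ciInf fun ψ => ?_
      have h1 := (f.comp (O i).subtypeL).le_opNorm ⟨P i φ - ψ, sub_mem (hrange i φ) ψ.2.2⟩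
      have h2 : f (P i φ) = f.comp (O i).subtypeL ⟨P i φ - ψ, sub_mem (hrange i φ) ψ.2.2⟩ := by
        simp [hf _ ψ.2.1]
      rw [h2]
      exact h1
    calc ‖f φ‖ = |∑ i, f (P i φ)| := by rw [← map_sum, hsum, Real.norm_eq_abs]
      _ ≤ ∑ i, |f (P i φ)| := Finset.abs_sum_le_sum_abs _ _
      _ ≤ ∑ i, ‖f.comp (O i).subtypeL‖ *
          ⨅ ψ : (VN ⊓ O i : Submodule ℝ Vh), ‖P i φ - ψ‖ :=
        Finset.sum_le_sum fun i _ => hloc i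
      _ ≤ _ := Real.sum_mul_le_sqrt_mul_sqrt _ _ _
      _ ≤ Real.sqrt (∑ i, ‖f.comp (O i).subtypeL‖ ^ 2) * (cN * ‖φ‖) :=
        mul_le_mul_of_nonneg_left (hstab φ) (Real.sqrt_nonneg _)
      _ = _ := by ring
end

section
/- Define the localized error estimator Δ_loc := (c_N/α)·(Σ_{i=1}^{M̃} ‖R(u_N)‖_{O_i'}²)^{1/2}, where R(u_N) is the residual functional R(u_N)(v) := f(v) − a(u_N, v). Then the estimator is robust and efficient: ‖u_h − u_N‖ ≤ Δ_loc ≤ (γ·√J·c_N/α)·‖u_h − u_N‖. -/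
open scoped RealInnerProductSpace

theorem bessel_aux {Vh : Type*} [NormedAddCommGroup Vh] [InnerProductSpace ℝ Vh]
    {ι : Type*} [DecidableEq ι] (s : Finset ι) (p : ι → Vh) (r : Vh)
    (horth : ∀ i ∈ s, ∀ j ∈ s, i ≠ j → ⟪p i, p j⟫ = 0)
    (hp : ∀ i ∈ s, ⟪r, p i⟫ = ‖p i‖ ^ 2) :
    ∑ i ∈ s, ‖p i‖ ^ 2 ≤ ‖r‖ ^ 2 := by
  have h1 : ⟪r, ∑ i ∈ s, p i⟫ = ∑ i ∈ s, ‖p i‖ ^ 2 := by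
    rw [inner_sum]
    exact Finset.sum_congr rfl hp
  have h2 : ‖∑ i ∈ s, p i‖ ^ 2 = ∑ i ∈ s, ‖p i‖ ^ 2 := by
    rw [← real_inner_self_eq_norm_sq, sum_inner]
    refine Finset.sum_congr rfl fun i hi => ?_
    rw [inner_sum, Finset.sum_eq_single i]
    · exact real_inner_self_eq_norm_sq _
    · intro j hj hne
      exact horth i hi j hj (Ne.symm hne)
    · intro h
      exact absurd hi h
  have h3 := norm_sub_sq_real r (∑ i ∈ s, p i)
  have h4 := sq_nonneg ‖r - ∑ i ∈ s, p i‖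
  linarith

theorem dual_aux {Vh : Type*} [NormedAddCommGroup Vh] [InnerProductSpace ℝ Vh]
    [FiniteDimensional ℝ Vh]
    (M J : ℕ) (O : Fin M → Submodule ℝ Vh)
    (grp : Fin M → Fin J)
    (horth : ∀ i₁ i₂, i₁ ≠ i₂ → grp i₁ = grp i₂ →
      ∀ x ∈ O i₁, ∀ y ∈ O i₂, ⟪x, y⟫ = 0) (R : Vh →L[ℝ] ℝ) :
    ∑ i, ‖R.comp (O i).subtypeL‖ ^ 2 ≤ J * ‖R‖ ^ 2 := by
  set r : Vh := (InnerProductSpace.toDual ℝ Vh).symm R with hr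
  have hR : ∀ v, R v = ⟪r, v⟫ := fun v => by
    rw [hr, InnerProductSpace.toDual_symm_apply]
  have hn : ‖r‖ = ‖R‖ := by rw [hr, LinearIsometryEquiv.norm_map]
  let p : Fin M → Vh := fun i => (O i).starProjection r
  have hpm : ∀ i, p i ∈ O i := fun i => Submodule.starProjection_apply_mem _ _
  have hpi : ∀ i, ∀ v ∈ O i, ⟪r, v⟫ = ⟪p i, v⟫ := fun i v hv => by
    have := Submodule.starProjection_inner_eq_zero (K := O i) r v hv
    rw [inner_sub_left] at this
    simp only [p]
    linarith
  have hle : ∀ i, ‖R.comp (O i).subtypeL‖ ≤ ‖p i‖ := fun i => by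
    refine ContinuousLinearMap.opNorm_le_bound _ (norm_nonneg _) fun v => ?_
    have : (R.comp (O i).subtypeL) v = ⟪p i, (v : Vh)⟫ := by
      rw [← hpi i v v.2, ← hR]; rfl
    rw [this]
    exact norm_inner_le_norm _ _
  calc ∑ i, ‖R.comp (O i).subtypeL‖ ^ 2 ≤ ∑ i, ‖p i‖ ^ 2 :=
        Finset.sum_le_sum fun i _ => pow_le_pow_left₀ (ContinuousLinearMap.opNorm_nonneg _) (hle i) 2
    _ = ∑ j, ∑ i with grp i = j, ‖p i‖ ^ 2 := (Finset.sum_fiberwise _ _ _).symm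
    _ ≤ ∑ _j : Fin J, ‖r‖ ^ 2 := by
        refine Finset.sum_le_sum fun j _ => bessel_aux _ p r ?_ ?_
        · intro i hi k hk hne
          simp only [Finset.mem_filter] at hi hk
          exact horth i k hne (hi.2.trans hk.2.symm) _ (hpm i) _ (hpm k)
        · intro i _
          rw [hpi i _ (hpm i), real_inner_self_eq_norm_sq]
    _ = J * ‖R‖ ^ 2 := by simp [hn]

/-- **Localized residual based a posteriori error estimate** (Corollary 5.2 of the paper).

Setting as in the localization theorem: `Vh` a finite-dimensional real Hilbert space,
subspaces `O i` with linear maps `P i` summing to the identity, a partition into `J`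
groups of mutually orthogonal subspaces, a reduced space `VN` with stability constant
`cN ≥ 0`. Moreover `a` is a continuous (`γ`) and coercive (`α > 0`) bilinear form,
`uh` solves the full problem `a(uh, v) = f(v)` for all `v ∈ Vh`, and `uN ∈ VN` is its
Galerkin approximation. Then, with the residual `R(uN) = f - a(uN, ·)`, the localized
estimator `Δloc := (cN/α)·(Σᵢ ‖R(uN)‖_{O i'}²)^{1/2}` is robust and efficient:
`‖uh - uN‖ ≤ Δloc ≤ (γ·√J·cN/α)·‖uh - uN‖`. -/
theorem localized_residual_error_estimate
    {Vh : Type*} [NormedAddCommGroup Vh] [InnerProductSpace ℝ Vh]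
    [FiniteDimensional ℝ Vh]
    (M J : ℕ) (O : Fin M → Submodule ℝ Vh)
    (P : Fin M → Vh →ₗ[ℝ] Vh)
    (hrange : ∀ i x, P i x ∈ O i)
    (hsum : ∀ x : Vh, (∑ i, P i x) = x)
    (grp : Fin M → Fin J)
    (horth : ∀ i₁ i₂, i₁ ≠ i₂ → grp i₁ = grp i₂ →
      ∀ x ∈ O i₁, ∀ y ∈ O i₂, ⟪x, y⟫ = 0)
    (VN : Submodule ℝ Vh) (cN : ℝ) (hcN : 0 ≤ cN)
    (hstab : ∀ φ : Vh,
      Real.sqrt (∑ i, (⨅ ψ : (VN ⊓ O i : Submodule ℝ Vh), ‖P i φ - ψ‖) ^ 2) ≤ cN * ‖φ‖)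
    (a : Vh →L[ℝ] Vh →L[ℝ] ℝ) (γ α : ℝ) (hα : 0 < α)
    (hcont : ∀ v w : Vh, a v w ≤ γ * (‖v‖ * ‖w‖))
    (hcoer : ∀ v : Vh, α * ‖v‖ ^ 2 ≤ a v v)
    (f : Vh →L[ℝ] ℝ)
    (uh : Vh) (huh : ∀ v : Vh, a uh v = f v)
    (uN : Vh) (huN : uN ∈ VN) (hgal : ∀ v ∈ VN, a uN v = f v) :
    ‖uh - uN‖ ≤
        (cN / α) * Real.sqrt (∑ i, ‖(f - a uN).comp (O i).subtypeL‖ ^ 2) ∧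
    (cN / α) * Real.sqrt (∑ i, ‖(f - a uN).comp (O i).subtypeL‖ ^ 2) ≤
        (γ * Real.sqrt J * cN / α) * ‖uh - uN‖ := by
  set R := f - a uN with hRdef
  set e := uh - uN with he
  have hR : ∀ v, R v = a e v := fun v => by
    simp [hRdef, he, huh]
  have hRN : ∀ v ∈ VN, R v = 0 := fun v hv => by
    simp [hRdef, hgal v hv]
  set S := Real.sqrt (∑ i, ‖R.comp (O i).subtypeL‖ ^ 2) with hS
  have hS0 : 0 ≤ S := Real.sqrt_nonneg _
  constructor
  · have hi : ∀ i, R (P i e) ≤ ‖R.comp (O i).subtypeL‖ *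
        (⨅ ψ : (VN ⊓ O i : Submodule ℝ Vh), ‖P i e - ψ‖) := fun i => by
      rw [Real.mul_iInf_of_nonneg (ContinuousLinearMap.opNorm_nonneg _)]
      refine le_ciInf fun ψ => ?_
      have hψ := Submodule.mem_inf.1 ψ.2
      have h1 : R (P i e) = (R.comp (O i).subtypeL) ⟨P i e - ψ, (O i).sub_mem (hrange i e) hψ.2⟩ := by
        simp [hRN _ hψ.1]
      rw [h1]
      have h3 := ContinuousLinearMap.le_opNorm (R.comp (O i).subtypeL)
        ⟨P i e - ψ, (O i).sub_mem (hrange i e) hψ.2⟩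
      exact (le_abs_self _).trans h3
    have h2 : α * ‖e‖ ^ 2 ≤ S * (cN * ‖e‖) := by
      calc α * ‖e‖ ^ 2 ≤ a e e := hcoer e
        _ = R e := (hR e).symm
        _ = ∑ i, R (P i e) := by rw [← map_sum, hsum]
        _ ≤ _ := Finset.sum_le_sum fun i _ => hi i
        _ ≤ _ := Real.sum_mul_le_sqrt_mul_sqrt _ _ _
        _ ≤ _ := mul_le_mul_of_nonneg_left (hstab e) hS0
    rw [div_mul_eq_mul_div, le_div_iff₀ hα]
    rcases (norm_nonneg e).eq_or_lt with h0 | h0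
    · rw [← h0]; simp; positivity
    · refine le_of_mul_le_mul_right ?_ h0
      nlinarith
  · have hγ : 0 ≤ γ * ‖e‖ := by
      rcases (norm_nonneg e).eq_or_lt with h0 | h0
      · simp [← h0]
      · refine nonneg_of_mul_nonneg_left (b := ‖e‖) ?_ h0
        have := (hcoer e).trans (hcont e e)
        have : 0 ≤ α * ‖e‖ ^ 2 := by positivity
        linarith
    have hRn : ‖R‖ ≤ γ * ‖e‖ := by
      refine ContinuousLinearMap.opNorm_le_bound _ hγ fun v => ?_
      rw [Real.norm_eq_abs, abs_le, hR]
      have h1 := hcont e v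
      have h2 := hcont e (-v)
      rw [map_neg, norm_neg] at h2
      constructor <;> linarith
    have hSle : S ≤ Real.sqrt J * (γ * ‖e‖) := by
      refine Real.sqrt_le_iff.2 ⟨by positivity, (dual_aux M J O grp horth R).trans ?_⟩
      rw [mul_pow, Real.sq_sqrt (Nat.cast_nonneg _)]
      gcongr
    calc cN / α * S ≤ cN / α * (Real.sqrt J * (γ * ‖e‖)) := by gcongr
      _ = _ := by ring
end

section
/- Let R̂ ⊆ ℝ^{N_R} be any linear subspace, P the M_R-orthogonal projection onto R̂, and B := 𝕋 − P𝕋. Let n_t ≥ 1, and let r_1, …, r_{n_t} be independent standard Gaussian vectors in ℝ^{N_S}. Let ε ∈ (0,1) and let s > 0 be such that ℙ(|g| ≤ √2·s)^{n_t} = ε, where g is a standard normal N(0,1) random variable (equivalently, s = erf^{-1}(ε^{1/n_t})), and set c_est := (√(2·λ_min(M_S)) · s)^{-1}. Then the randomized a posteriori norm estimator Δ := c_est · max_{1≤i≤n_t} ‖B r_i‖_R is an upper bound for ‖B‖ with probability at least 1 − ε, i.e. ℙ( ‖𝕋 − P𝕋‖ ≤ c_est · max_{1≤i≤n_t} ‖(𝕋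 − P𝕋) r_i‖_R ) ≥ 1 − ε. -/
open Matrix MeasureTheory ProbabilityTheory

/-- The norm on `ℝ^N` induced by a symmetric positive definite matrix `M`:
`‖x‖_M = √(xᵀ M x)`. -/
noncomputable def matWeightedNorm {N : ℕ} (M : Matrix (Fin N) (Fin N) ℝ)
    (x : Fin N → ℝ) : ℝ :=
  Real.sqrt (x ⬝ᵥ M.mulVec x)

/-- The operator "norm" of a map `f : ℝ^{NS} → ℝ^{NR}` induced by the weighted norms
`‖·‖_{MS}` on the source and `‖·‖_{MR}` on the range. -/
noncomputable def matWeightedOpNorm {NS NR : ℕ} (MS : Matrix (Fin NS) (Fin NS) ℝ)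
    (MR : Matrix (Fin NR) (Fin NR) ℝ) (f : (Fin NS → ℝ) → (Fin NR → ℝ)) : ℝ :=
  sSup {t : ℝ | ∃ x : Fin NS → ℝ, x ≠ 0 ∧
    t = matWeightedNorm MR (f x) / matWeightedNorm MS x}

/-- The law of a standard Gaussian vector in `ℝ^N`. -/
noncomputable def stdGaussianVec (N : ℕ) : Measure (Fin N → ℝ) :=
  Measure.pi fun _ => gaussianReal 0 1

/-- A unit linear functional of a standard Gaussian vector is standard normal. -/
lemma map_dot_stdGaussianVec {N : ℕ} (u : Fin N → ℝ) (hu : u ⬝ᵥ u = 1) :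
    (stdGaussianVec N).map (fun x => u ⬝ᵥ x) = gaussianReal 0 1 := by
  have hmeas : Measurable (fun x : Fin N → ℝ => u ⬝ᵥ x) := by
    unfold dotProduct; fun_prop
  haveI : IsProbabilityMeasure (stdGaussianVec N) := by unfold stdGaussianVec; infer_instance
  haveI : IsProbabilityMeasure ((stdGaussianVec N).map (fun x => u ⬝ᵥ x)) :=
    Measure.isProbabilityMeasure_map hmeas.aemeasurable
  apply Measure.ext_of_charFun
  ext t
  rw [charFun_apply_real, integral_map hmeas.aemeasurable
    (Measurable.aestronglyMeasurable (by fun_prop)), charFun_gaussianReal, stdGaussianVec]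
  have h1 : ∀ x : Fin N → ℝ, Complex.exp (t * ((u ⬝ᵥ x : ℝ) : ℂ) * Complex.I)
      = ∏ i, Complex.exp (((t * u i : ℝ) : ℂ) * (x i : ℂ) * Complex.I) := by
    intro x
    rw [← Complex.exp_sum]
    congr 1
    simp only [dotProduct, Complex.ofReal_sum, Complex.ofReal_mul, Finset.mul_sum, Finset.sum_mul]
    exact Finset.sum_congr rfl fun i _ => by ring
  simp_rw [h1]
  rw [integral_fintype_prod_eq_prod
    (f := fun i (y : ℝ) => Complex.exp (((t * u i : ℝ) : ℂ) * (y : ℂ) * Complex.I))]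
  simp_rw [← charFun_apply_real, charFun_gaussianReal]
  rw [← Complex.exp_sum]
  congr 1
  have h2 : ((∑ i, u i * u i : ℝ) : ℂ) = 1 := by
    have : ∑ i, u i * u i = 1 := hu
    rw [this]; simp
  push_cast at h2 ⊢
  calc _ = ∑ i, (u i * u i : ℂ) * (-(t : ℂ) ^ 2 / 2) :=
        Finset.sum_congr rfl fun i _ => by ring
    _ = _ := by rw [← Finset.sum_mul, h2]; ring

lemma weighted_cauchy_schwarz {N : ℕ} (M : Matrix (Fin N) (Fin N) ℝ) (hs : M.IsSymm)
    (hpos : ∀ y : Fin N → ℝ, y ≠ 0 → 0 < y ⬝ᵥ M.mulVec y) (y z : Fin N → ℝ) :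
    (y ⬝ᵥ M.mulVec z) ^ 2 ≤ (y ⬝ᵥ M.mulVec y) * (z ⬝ᵥ M.mulVec z) := by
  by_cases hy : y = 0
  · simp [hy]
  have hsym : z ⬝ᵥ M.mulVec y = y ⬝ᵥ M.mulVec z := by
    rw [dotProduct_mulVec, ← mulVec_transpose, hs.eq, dotProduct_comm]
  have hb := hpos y hy
  have hnn : ∀ w : Fin N → ℝ, 0 ≤ w ⬝ᵥ M.mulVec w := by
    intro w
    by_cases hw : w = 0
    · simp [hw]
    · exact (hpos w hw).le
  have h := hnn ((y ⬝ᵥ M.mulVec y) • z - (y ⬝ᵥ M.mulVec z) • y)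
  simp only [mulVec_sub, mulVec_smul, dotProduct_sub, sub_dotProduct, smul_dotProduct,
    dotProduct_smul, smul_eq_mul, hsym] at h
  have h' : 0 ≤ (y ⬝ᵥ M.mulVec y) *
      ((y ⬝ᵥ M.mulVec y) * (z ⬝ᵥ M.mulVec z) - (y ⬝ᵥ M.mulVec z) ^ 2) := by linarith
  have := nonneg_of_mul_nonneg_right h' hb
  linarith

/-- The supremum defining the operator norm is attained. -/
lemma opNorm_attained {NS NR : ℕ} (hNS : 1 ≤ NS) (MS : Matrix (Fin NS) (Fin NS) ℝ)
    (MR : Matrix (Fin NR) (Fin NR) ℝ)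
    (hMSpos : ∀ x : Fin NS → ℝ, x ≠ 0 → 0 < x ⬝ᵥ MS.mulVec x)
    (B : Matrix (Fin NR) (Fin NS) ℝ) :
    ∃ x0 : Fin NS → ℝ, x0 ≠ 0 ∧ matWeightedOpNorm MS MR (fun x => B.mulVec x) =
      matWeightedNorm MR (B.mulVec x0) / matWeightedNorm MS x0 := by
  haveI : Nonempty (Fin NS) := ⟨⟨0, hNS⟩⟩
  have hc : IsCompact (Metric.sphere (0 : Fin NS → ℝ) 1) := isCompact_sphere _ _
  have hne : (Metric.sphere (0 : Fin NS → ℝ) 1).Nonempty :=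
    NormedSpace.sphere_nonempty.2 zero_le_one
  have hns : ∀ x ∈ Metric.sphere (0 : Fin NS → ℝ) 1, x ≠ 0 := by
    intro x hx h
    simp [h] at hx
  have hcont : ContinuousOn (fun x : Fin NS → ℝ =>
      matWeightedNorm MR (B.mulVec x) / matWeightedNorm MS x)
      (Metric.sphere (0 : Fin NS → ℝ) 1) := by
    apply ContinuousOn.div
    · unfold matWeightedNorm
      exact Continuous.continuousOn (by fun_prop)
    · unfold matWeightedNorm
      exact Continuous.continuousOn (by fun_prop)
    · intro x hx
      exact (Real.sqrt_pos.2 (hMSpos x (hns x hx))).ne'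
  obtain ⟨x0, hx0, hmax⟩ := hc.exists_isMaxOn hne hcont
  refine ⟨x0, hns x0 hx0, ?_⟩
  have hg : IsGreatest {t : ℝ | ∃ x : Fin NS → ℝ, x ≠ 0 ∧
    t = matWeightedNorm MR (B.mulVec x) / matWeightedNorm MS x}
      (matWeightedNorm MR (B.mulVec x0) / matWeightedNorm MS x0) := by
    refine ⟨⟨x0, hns x0 hx0, rfl⟩, ?_⟩
    rintro t ⟨x, hx, rfl⟩
    have hxn : 0 < ‖x‖ := norm_pos_iff.2 hx
    have hmem : ‖x‖⁻¹ • x ∈ Metric.sphere (0 : Fin NS → ℝ) 1 := by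
      simp [norm_smul, hxn.ne']
    have hm := hmax hmem
    have hsc : ∀ {N : ℕ} (M : Matrix (Fin N) (Fin N) ℝ) (y : Fin N → ℝ),
        matWeightedNorm M (‖x‖⁻¹ • y) = ‖x‖⁻¹ * matWeightedNorm M y := by
      intro N M y
      unfold matWeightedNorm
      rw [mulVec_smul, dotProduct_smul, smul_dotProduct, smul_eq_mul, smul_eq_mul, ← mul_assoc,
        Real.sqrt_mul (by positivity), Real.sqrt_mul_self (by positivity)]
    simp only [Set.mem_setOf_eq, mulVec_smul, hsc] at hm
    rwa [mul_div_mul_left _ _ (inv_ne_zero hxn.ne')] at hm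
  exact hg.csSup_eq

lemma exists_unit_functional {NS NR : ℕ} (hNS : 1 ≤ NS)
    (MS : Matrix (Fin NS) (Fin NS) ℝ) (MR : Matrix (Fin NR) (Fin NR) ℝ)
    (hMRsymm : MR.IsSymm)
    (hMSpos : ∀ x : Fin NS → ℝ, x ≠ 0 → 0 < x ⬝ᵥ MS.mulVec x)
    (hMRpos : ∀ y : Fin NR → ℝ, y ≠ 0 → 0 < y ⬝ᵥ MR.mulVec y)
    (lam : ℝ) (hl : 0 < lam)
    (hlam : ∀ x : Fin NS → ℝ, lam * (x ⬝ᵥ x) ≤ x ⬝ᵥ MS.mulVec x)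
    (B : Matrix (Fin NR) (Fin NS) ℝ) :
    0 ≤ matWeightedOpNorm MS MR (fun x => B.mulVec x) ∧
    ∃ u : Fin NS → ℝ, u ⬝ᵥ u = 1 ∧ ∀ r, matWeightedOpNorm MS MR (fun x => B.mulVec x) *
      Real.sqrt lam * |u ⬝ᵥ r| ≤ matWeightedNorm MR (B.mulVec r) := by
  obtain ⟨x0, hx0, hσ⟩ := opNorm_attained hNS MS MR hMSpos B
  rw [hσ]
  have hnn : ∀ y : Fin NR → ℝ, 0 ≤ y ⬝ᵥ MR.mulVec y := by
    intro w
    by_cases hw : w = 0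
    · simp [hw]
    · exact (hMRpos w hw).le
  refine ⟨div_nonneg (Real.sqrt_nonneg _) (Real.sqrt_nonneg _), ?_⟩
  by_cases hB : B.mulVec x0 = 0
  · refine ⟨Pi.single ⟨0, hNS⟩ 1, by simp, fun r => ?_⟩
    have : matWeightedNorm MR (0 : Fin NR → ℝ) = 0 := by simp [matWeightedNorm]
    rw [hB, this]
    simp [matWeightedNorm, Real.sqrt_nonneg]
  set a : Fin NS → ℝ := (B.mulVec x0) ᵥ* (MR * B) with ha
  have har : ∀ r, a ⬝ᵥ r = B.mulVec x0 ⬝ᵥ MR.mulVec (B.mulVec r) := by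
    intro r
    rw [ha, ← dotProduct_mulVec, mulVec_mulVec]
  have hβ := hMRpos _ hB
  have hm := hMSpos _ hx0
  set β := B.mulVec x0 ⬝ᵥ MR.mulVec (B.mulVec x0) with hβd
  set m := x0 ⬝ᵥ MS.mulVec x0 with hmd
  have hcs : (a ⬝ᵥ x0) ^ 2 ≤ (a ⬝ᵥ a) * (x0 ⬝ᵥ x0) := by
    simp only [dotProduct, ← sq]
    exact Finset.sum_mul_sq_le_sq_mul_sq _ _ _
  rw [har] at hcs
  change β ^ 2 ≤ _ at hcs
  have hxx : 0 ≤ x0 ⬝ᵥ x0 := Finset.sum_nonneg fun i _ => mul_self_nonneg _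
  have haa : 0 < a ⬝ᵥ a := by
    have : 0 < (a ⬝ᵥ a) * (x0 ⬝ᵥ x0) := lt_of_lt_of_le (by positivity) hcs
    exact pos_of_mul_pos_left this hxx
  set A := a ⬝ᵥ a with hA
  refine ⟨(Real.sqrt A)⁻¹ • a, ?_, fun r => ?_⟩
  · rw [smul_dotProduct, dotProduct_smul, smul_eq_mul, smul_eq_mul, ← mul_assoc, ← mul_inv,
      Real.mul_self_sqrt haa.le, ← hA, inv_mul_cancel₀ haa.ne']
  · have hq := weighted_cauchy_schwarz MR hMRsymm hMRpos (B.mulVec x0) (B.mulVec r)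
    rw [← har] at hq
    have hl0 := hlam x0
    unfold matWeightedNorm
    apply Real.le_sqrt_of_sq_le
    rw [← hβd, ← hmd, smul_dotProduct, smul_eq_mul, mul_pow, mul_pow, div_pow, sq_abs, mul_pow,
      inv_pow, Real.sq_sqrt hβ.le, Real.sq_sqrt hm.le, Real.sq_sqrt hl.le, Real.sq_sqrt haa.le]
    set q := B.mulVec r ⬝ᵥ MR.mulVec (B.mulVec r)
    have hq0 : 0 ≤ q := hnn _
    have e : β / m * lam * (A⁻¹ * (a ⬝ᵥ r) ^ 2) = (β * lam * (a ⬝ᵥ r) ^ 2) / (m * A) := by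
      field_simp
    rw [e, div_le_iff₀ (by positivity)]
    calc β * lam * (a ⬝ᵥ r) ^ 2 ≤ β * lam * (β * q) := by gcongr
      _ = (lam * q) * β ^ 2 := by ring
      _ ≤ (lam * q) * (A * (x0 ⬝ᵥ x0)) := by gcongr
      _ = (q * A) * (lam * (x0 ⬝ᵥ x0)) := by ring
      _ ≤ (q * A) * m := by gcongr
      _ = _ := by ring

lemma exists_matrix_residual {NS NR : ℕ} (MR : Matrix (Fin NR) (Fin NR) ℝ)
    (hMRpos : ∀ y : Fin NR → ℝ, y ≠ 0 → 0 < y ⬝ᵥ MR.mulVec y)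
    (T : Matrix (Fin NR) (Fin NS) ℝ)
    (Rhat : Submodule ℝ (Fin NR → ℝ))
    (P : (Fin NR → ℝ) → (Fin NR → ℝ))
    (hP_mem : ∀ y, P y ∈ Rhat)
    (hP_orth : ∀ y, ∀ w ∈ Rhat, (y - P y) ⬝ᵥ MR.mulVec w = 0) :
    ∃ B : Matrix (Fin NR) (Fin NS) ℝ, ∀ x, T.mulVec x - P (T.mulVec x) = B.mulVec x := by
  have hz : ∀ w ∈ Rhat, w ⬝ᵥ MR.mulVec w = 0 → w = 0 := by
    intro w _ h
    by_contra hw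
    exact (hMRpos w hw).ne' h
  have hadd : ∀ y z, P (y + z) = P y + P z := by
    intro y z
    have hw : P (y + z) - (P y + P z) ∈ Rhat :=
      Rhat.sub_mem (hP_mem _) (Rhat.add_mem (hP_mem _) (hP_mem _))
    refine sub_eq_zero.1 (hz _ hw ?_)
    have e : P (y + z) - (P y + P z) = (y - P y) + (z - P z) - ((y + z) - P (y + z)) := by abel
    nth_rewrite 1 [e]
    rw [sub_dotProduct, add_dotProduct, hP_orth _ _ hw, hP_orth _ _ hw, hP_orth _ _ hw]
    simp
  have hsmul : ∀ (c : ℝ) y, P (c • y) = c • P y := by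
    intro c y
    have hw : P (c • y) - c • P y ∈ Rhat :=
      Rhat.sub_mem (hP_mem _) (Rhat.smul_mem _ (hP_mem _))
    refine sub_eq_zero.1 (hz _ hw ?_)
    have e : P (c • y) - c • P y = c • (y - P y) - (c • y - P (c • y)) := by
      rw [smul_sub]; abel
    nth_rewrite 1 [e]
    rw [sub_dotProduct, smul_dotProduct, hP_orth _ _ hw, hP_orth _ _ hw]
    simp
  let PL : (Fin NR → ℝ) →ₗ[ℝ] (Fin NR → ℝ) := ⟨⟨P, hadd⟩, hsmul⟩
  refine ⟨T - LinearMap.toMatrix' PL * T, fun x => ?_⟩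
  rw [sub_mulVec, ← mulVec_mulVec, LinearMap.toMatrix'_mulVec]
  rfl

/-- **The randomized a posteriori norm estimator is an upper bound with high probability**
(first part of Proposition `errest_reliable` of the paper, following [BuhSme18]).

`Rhat` is a subspace of `ℝ^{NR}`, `P` the `MR`-orthogonal projection onto it (characterized
by `hP_mem`, `hP_orth`), and `B := T − P T` (as the map `x ↦ T x − P (T x)`). For `nt ≥ 1`
i.i.d. standard Gaussian test vectors `r 0, …, r (nt-1)` in `ℝ^{NS}`, `ε ∈ (0,1)`, and `s > 0`
with `ℙ(|g| ≤ √2·s)^{nt} = ε` (i.e. `s = erf⁻¹(ε^{1/nt})`), set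
`c_est := (√(2·λmin(MS))·s)⁻¹`. Then
`ℙ( ‖T − P T‖ ≤ c_est · maxᵢ ‖B rᵢ‖_R ) ≥ 1 − ε`. -/
theorem randomized_a_posteriori_estimator_reliable
    (NS NR : ℕ) (hNS : 1 ≤ NS) (hNR : 1 ≤ NR)
    (MS : Matrix (Fin NS) (Fin NS) ℝ) (MR : Matrix (Fin NR) (Fin NR) ℝ)
    (hMSsymm : MS.IsSymm) (hMRsymm : MR.IsSymm)
    (hMSpos : ∀ x : Fin NS → ℝ, x ≠ 0 → 0 < x ⬝ᵥ MS.mulVec x)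
    (hMRpos : ∀ y : Fin NR → ℝ, y ≠ 0 → 0 < y ⬝ᵥ MR.mulVec y)
    (lamMinS : ℝ)
    (hminS : IsLeast {t : ℝ | ∃ x : Fin NS → ℝ, x ≠ 0 ∧
      t = (x ⬝ᵥ MS.mulVec x) / (x ⬝ᵥ x)} lamMinS)
    (T : Matrix (Fin NR) (Fin NS) ℝ)
    (Rhat : Submodule ℝ (Fin NR → ℝ))
    (P : (Fin NR → ℝ) → (Fin NR → ℝ))
    (hP_mem : ∀ y, P y ∈ Rhat)
    (hP_orth : ∀ y, ∀ w ∈ Rhat, (y - P y) ⬝ᵥ MR.mulVec w = 0)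
    (nt : ℕ) (hnt : 1 ≤ nt)
    (ε : ℝ) (hε : ε ∈ Set.Ioo (0 : ℝ) 1)
    (s : ℝ) (hs : 0 < s)
    (hsdef : ((gaussianReal 0 1) {x : ℝ | |x| ≤ Real.sqrt 2 * s}).toReal ^ nt = ε) :
    1 - ε ≤
      ((Measure.pi fun _ : Fin nt => stdGaussianVec NS)
        {r | matWeightedOpNorm MS MR (fun x => T.mulVec x - P (T.mulVec x)) ≤
          (Real.sqrt (2 * lamMinS) * s)⁻¹ *
            ⨆ i : Fin nt,
              matWeightedNorm MR (T.mulVec (r i) - P (T.mulVec (r i)))}).toReal := by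
  obtain ⟨B, hB⟩ := exists_matrix_residual MR hMRpos T Rhat P hP_mem hP_orth
  simp_rw [hB]
  obtain ⟨⟨x1, hx1, hl1⟩, hlb⟩ := hminS
  have hdot : ∀ x : Fin NS → ℝ, x ≠ 0 → 0 < x ⬝ᵥ x := by
    intro x hx
    refine lt_of_le_of_ne (Finset.sum_nonneg fun i _ => mul_self_nonneg _) (Ne.symm ?_)
    rwa [Ne, dotProduct_self_eq_zero]
  have hl : 0 < lamMinS := by
    rw [hl1]
    exact div_pos (hMSpos _ hx1) (hdot _ hx1)
  have hlam : ∀ x : Fin NS → ℝ, lamMinS * (x ⬝ᵥ x) ≤ x ⬝ᵥ MS.mulVec x := by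
    intro x
    by_cases hx : x = 0
    · simp [hx]
    · exact (le_div_iff₀ (hdot x hx)).1 (hlb ⟨x, hx, rfl⟩)
  obtain ⟨hσ0, u, hu, hur⟩ :=
    exists_unit_functional hNS MS MR hMRsymm hMSpos hMRpos lamMinS hl hlam B
  set σ := matWeightedOpNorm MS MR (fun x => B.mulVec x)
  haveI : IsProbabilityMeasure (stdGaussianVec NS) := by unfold stdGaussianVec; infer_instance
  set μ := Measure.pi fun _ : Fin nt => stdGaussianVec NS with hμ
  have hmeas : Measurable (fun x : Fin NS → ℝ => u ⬝ᵥ x) := by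
    unfold dotProduct; fun_prop
  have hI : MeasurableSet {x : ℝ | |x| ≤ Real.sqrt 2 * s} :=
    measurableSet_le (by fun_prop) measurable_const
  set S : Set (Fin NS → ℝ) := (fun x => u ⬝ᵥ x) ⁻¹' {x : ℝ | |x| ≤ Real.sqrt 2 * s} with hS
  have hSm : MeasurableSet S := hmeas hI
  have hSv : stdGaussianVec NS S = gaussianReal 0 1 {x : ℝ | |x| ≤ Real.sqrt 2 * s} := by
    rw [← map_dot_stdGaussianVec u hu, Measure.map_apply hmeas hI]
  set bad : Set (Fin nt → Fin NS → ℝ) := Set.univ.pi fun _ => S with hbad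
  have hbm : MeasurableSet bad := MeasurableSet.univ_pi fun _ => hSm
  have hbv : μ.real bad = ε := by
    rw [Measure.real, hμ, hbad, Measure.pi_pi, hSv]
    simpa using hsdef
  have hcompl : μ.real badᶜ = 1 - ε := by
    rw [probReal_compl_eq_one_sub hbm, hbv]
  rw [← hcompl]
  refine measureReal_mono ?_
  intro r hr
  have hr' : ∃ i, Real.sqrt 2 * s < |u ⬝ᵥ r i| := by
    by_contra! h
    exact hr fun i _ => h i
  obtain ⟨i, hi⟩ := hr'
  have h1 : σ * Real.sqrt lamMinS * (Real.sqrt 2 * s) ≤ matWeightedNorm MR (B.mulVec (r i)) :=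
    le_trans (by gcongr) (hur (r i))
  have h2 : matWeightedNorm MR (B.mulVec (r i)) ≤
      ⨆ i : Fin nt, matWeightedNorm MR (B.mulVec (r i)) :=
    le_ciSup (f := fun i => matWeightedNorm MR (B.mulVec (r i)))
      (Set.finite_range _).bddAbove i
  show σ ≤ _
  rw [← div_eq_inv_mul, le_div_iff₀ (by positivity), Real.sqrt_mul (by norm_num)]
  linarith
end

section
/- Let R̂ ⊆ ℝ^{N_R} be any linear subspace, P the M_R-orthogonal projection onto R̂, and B := 𝕋 − P𝕋, assumed nonzero. Let n_t ≥ 1, let r_1, …, r_{n_t} be independent standard Gaussian vectors in ℝ^{N_S}, let ε ∈ (0,1), let s > 0 satisfy ℙ(|g| ≤ √2·s)^{n_t} = ε for a standard normal g (i.e. s = erf^{-1}(ε^{1/n_t})), and set c_est := (√(2·λ_min(M_S)) · s)^{-1}. Let N_T := rank 𝕋 and let x > 0 satisfy ℙ(Σ_{i=1}^{N_T} z_i² ≥ 2x) = ε/n_t for a standard Gaussian vector z in ℝ^{N_T} (equivalently, x = Q^{-1}(N_T/2, ε/n_t) with Q the normalized upper incomplete gamma function), and set c_eff := ( x · (λ_max(M_S)/λ_min(M_S))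 · s^{-2} )^{1/2}. Then the estimator Δ := c_est · max_{1≤i≤n_t} ‖B r_i‖_R overestimates the true norm by at most the factor c_eff with probability at least 1 − ε, i.e. ℙ( Δ ≤ c_eff · ‖B‖ ) ≥ 1 − ε. -/
open Matrix MeasureTheory ProbabilityTheory

lemma map_isometry_adj {n k : ℕ} (L : EuclideanSpace ℝ (Fin n) →L[ℝ] EuclideanSpace ℝ (Fin k))
    (A : EuclideanSpace ℝ (Fin k) → EuclideanSpace ℝ (Fin n))
    (hA : ∀ v t, inner ℝ (L v) t = inner ℝ v (A t)) (hn : ∀ t, ‖A t‖ = ‖t‖) :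
    (stdGaussian (EuclideanSpace ℝ (Fin n))).map L = stdGaussian (EuclideanSpace ℝ (Fin k)) := by
  have : IsProbabilityMeasure ((stdGaussian (EuclideanSpace ℝ (Fin n))).map L) :=
    Measure.isProbabilityMeasure_map (by fun_prop)
  apply Measure.ext_of_charFun
  ext t
  rw [charFun_stdGaussian, ← hn t, ← charFun_stdGaussian, charFun_apply, charFun_apply,
    integral_map (by fun_prop) (by fun_prop)]
  simp_rw [hA]

lemma gauss_proj {m n : ℕ} (T : Matrix (Fin m) (Fin n) ℝ) :
    ∃ L : (Fin n → ℝ) → (Fin T.rank → ℝ), Measurable L ∧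
      (stdGaussianVec n).map L = stdGaussianVec T.rank ∧
      ∀ v, ∃ w, T.mulVec w = T.mulVec v ∧ w ⬝ᵥ w = ∑ i, (L v i) ^ 2 := by
  classical
  let E := EuclideanSpace ℝ (Fin n)
  let f : E →ₗ[ℝ] (Fin m → ℝ) := T.mulVecLin ∘ₗ (WithLp.linearEquiv 2 ℝ (Fin n → ℝ)).toLinearMap
  let K : Submodule ℝ E := LinearMap.ker f
  have hrank : Module.finrank ℝ Kᗮ = T.rank := by
    have h1 := K.finrank_add_finrank_orthogonal
    have h2 := f.finrank_range_add_finrank_ker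
    have h3 : LinearMap.range f = LinearMap.range T.mulVecLin := by
      simp [f, LinearMap.range_comp]
    rw [h3] at h2
    change T.rank + Module.finrank ℝ K = _ at h2
    omega
  let b : OrthonormalBasis (Fin T.rank) ℝ Kᗮ := (stdOrthonormalBasis ℝ Kᗮ).reindex (finCongr hrank)
  let L : E →L[ℝ] EuclideanSpace ℝ (Fin T.rank) :=
    (b.repr.toContinuousLinearEquiv : Kᗮ →L[ℝ] EuclideanSpace ℝ (Fin T.rank)) ∘L
      Kᗮ.orthogonalProjectionOnto
  have hL : (stdGaussian E).map L = stdGaussian (EuclideanSpace ℝ (Fin T.rank)) := by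
    apply map_isometry_adj L (fun t => ((b.repr.symm t : Kᗮ) : E))
    · intro v t
      have h1 : inner ℝ (L v) t = inner ℝ (Kᗮ.orthogonalProjectionOnto v) (b.repr.symm t) := by
        rw [← b.repr.inner_map_map]
        simp [L]
      rw [h1]
      exact Submodule.inner_orthogonalProjectionOnto_eq_of_mem_right (b.repr.symm t) v
    · intro t
      exact (Submodule.coe_norm _).symm.trans (b.repr.symm.norm_map t)
  refine ⟨fun v => WithLp.ofLp (L (WithLp.toLp 2 v)), ?_, ?_, ?_⟩
  · fun_prop
  · have : (fun v : Fin n → ℝ => WithLp.ofLp (L (WithLp.toLp 2 v))) =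
        (WithLp.ofLp ∘ L) ∘ (WithLp.toLp 2) := rfl
    rw [this, ← Measure.map_map (by fun_prop) (by fun_prop), stdGaussianVec,
      map_pi_eq_stdGaussian, ← Measure.map_map (by fun_prop) (by fun_prop), hL,
      ← map_pi_eq_stdGaussian, Measure.map_map (by fun_prop) (by fun_prop)]
    exact Measure.map_id
  · intro v
    let u : E := WithLp.toLp 2 v
    refine ⟨WithLp.ofLp (Kᗮ.orthogonalProjectionOnto u : E), ?_, ?_⟩
    · have h : u - (Kᗮ.orthogonalProjectionOnto u : E) ∈ K := by
        have := Kᗮ.sub_starProjection_mem_orthogonal u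
        rwa [Submodule.orthogonal_orthogonal] at this
      have h' : f (u - (Kᗮ.orthogonalProjectionOnto u : E)) = 0 := h
      rw [map_sub, sub_eq_zero] at h'
      exact h'.symm
    · have h1 : ‖L u‖ ^ 2 = ‖(Kᗮ.orthogonalProjectionOnto u : E)‖ ^ 2 := by
        simp [L]
      rw [EuclideanSpace.real_norm_sq_eq, EuclideanSpace.real_norm_sq_eq] at h1
      change _ = ∑ i, (L u i) ^ 2
      rw [h1]
      simp [dotProduct, pow_two]

lemma quad_bound {n : ℕ} (A : Matrix (Fin n) (Fin n) ℝ) :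
    ∃ C : ℝ, 0 ≤ C ∧ ∀ v : Fin n → ℝ, v ⬝ᵥ A.mulVec v ≤ C * (v ⬝ᵥ v) := by
  refine ⟨‖toEuclideanCLM (𝕜 := ℝ) A‖, norm_nonneg _, fun v => ?_⟩
  let u : EuclideanSpace ℝ (Fin n) := WithLp.toLp 2 v
  have h1 : v ⬝ᵥ A.mulVec v = inner ℝ u (toEuclideanCLM (𝕜 := ℝ) A u) := by
    simp [u, EuclideanSpace.inner_eq_star_dotProduct, dotProduct_comm]
  have h2 : v ⬝ᵥ v = ‖u‖ ^ 2 := by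
    rw [EuclideanSpace.real_norm_sq_eq]; simp [u, dotProduct, pow_two]
  rw [h1, h2]
  calc _ ≤ ‖u‖ * ‖toEuclideanCLM (𝕜 := ℝ) A u‖ := real_inner_le_norm _ _
    _ ≤ ‖u‖ * (‖toEuclideanCLM (𝕜 := ℝ) A‖ * ‖u‖) := by
      gcongr; exact ContinuousLinearMap.le_opNorm _ _
    _ = _ := by ring

/-- **Effectivity of the randomized a posteriori norm estimator**
(second part of Proposition `errest_reliable` of the paper, following [BuhSme18]).

With `B := T − P T` nonzero, `nt ≥ 1` i.i.d. standard Gaussian test vectors, `ε ∈ (0,1)`,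
`s = erf⁻¹(ε^{1/nt}) > 0` (characterized by `ℙ(|g| ≤ √2·s)^{nt} = ε` for `g ~ N(0,1)`),
`c_est := (√(2·λmin(MS))·s)⁻¹`, `NT := rank T`, `x = Q⁻¹(NT/2, ε/nt) > 0` (characterized by
`ℙ(Σᵢ zᵢ² ≥ 2x) = ε/nt` for a standard Gaussian vector `z` in `ℝ^{NT}`), and
`c_eff := (x·(λmax(MS)/λmin(MS))·s⁻²)^{1/2}`, the estimator
`Δ := c_est · maxᵢ ‖B rᵢ‖_R` satisfies `ℙ( Δ ≤ c_eff·‖B‖ ) ≥ 1 − ε`. -/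
theorem randomized_a_posteriori_estimator_effectivity
    (NS NR : ℕ) (hNS : 1 ≤ NS) (hNR : 1 ≤ NR)
    (MS : Matrix (Fin NS) (Fin NS) ℝ) (MR : Matrix (Fin NR) (Fin NR) ℝ)
    (hMSsymm : MS.IsSymm) (hMRsymm : MR.IsSymm)
    (hMSpos : ∀ x : Fin NS → ℝ, x ≠ 0 → 0 < x ⬝ᵥ MS.mulVec x)
    (hMRpos : ∀ y : Fin NR → ℝ, y ≠ 0 → 0 < y ⬝ᵥ MR.mulVec y)
    (lamMinS lamMaxS : ℝ)
    (hminS : IsLeast {t : ℝ | ∃ x : Fin NS → ℝ, x ≠ 0 ∧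
      t = (x ⬝ᵥ MS.mulVec x) / (x ⬝ᵥ x)} lamMinS)
    (hmaxS : IsGreatest {t : ℝ | ∃ x : Fin NS → ℝ, x ≠ 0 ∧
      t = (x ⬝ᵥ MS.mulVec x) / (x ⬝ᵥ x)} lamMaxS)
    (T : Matrix (Fin NR) (Fin NS) ℝ)
    (Rhat : Submodule ℝ (Fin NR → ℝ))
    (P : (Fin NR → ℝ) → (Fin NR → ℝ))
    (hP_mem : ∀ y, P y ∈ Rhat)
    (hP_orth : ∀ y, ∀ w ∈ Rhat, (y - P y) ⬝ᵥ MR.mulVec w = 0)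
    (hB_ne : ∃ x0 : Fin NS → ℝ, T.mulVec x0 - P (T.mulVec x0) ≠ 0)
    (nt : ℕ) (hnt : 1 ≤ nt)
    (ε : ℝ) (hε : ε ∈ Set.Ioo (0 : ℝ) 1)
    (s : ℝ) (hs : 0 < s)
    (hsdef : ((gaussianReal 0 1) {x : ℝ | |x| ≤ Real.sqrt 2 * s}).toReal ^ nt = ε)
    (x : ℝ) (hx : 0 < x)
    (hxdef : ((Measure.pi fun _ : Fin T.rank => gaussianReal 0 1)
      {z : Fin T.rank → ℝ | 2 * x ≤ ∑ i, (z i) ^ 2}).toReal = ε / nt) :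
    1 - ε ≤
      ((Measure.pi fun _ : Fin nt => stdGaussianVec NS)
        {r | (Real.sqrt (2 * lamMinS) * s)⁻¹ *
              (⨆ i : Fin nt,
                matWeightedNorm MR (T.mulVec (r i) - P (T.mulVec (r i)))) ≤
            Real.sqrt (x * (lamMaxS / lamMinS) * (s ^ 2)⁻¹) *
              matWeightedOpNorm MS MR
                (fun v => T.mulVec v - P (T.mulVec v))}).toReal := by
  obtain ⟨hε0, hε1⟩ := hε
  have : Nonempty (Fin nt) := ⟨⟨0, hnt⟩⟩
  have hdot : ∀ v : Fin NS → ℝ, v ≠ 0 → 0 < v ⬝ᵥ v := fun v hv => by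
    have h0 : 0 ≤ v ⬝ᵥ v := by
      simp only [dotProduct]; exact Finset.sum_nonneg fun i _ => mul_self_nonneg _
    exact lt_of_le_of_ne h0 fun h => hv (dotProduct_self_eq_zero.1 h.symm)
  have hmin0 : 0 < lamMinS := by
    obtain ⟨v, hv, h⟩ := hminS.1
    rw [h]; exact div_pos (hMSpos v hv) (hdot v hv)
  have hmax0 : 0 < lamMaxS := by
    obtain ⟨v, hv, h⟩ := hmaxS.1
    rw [h]; exact div_pos (hMSpos v hv) (hdot v hv)
  have hmin : ∀ v : Fin NS → ℝ, v ≠ 0 → lamMinS * (v ⬝ᵥ v) ≤ v ⬝ᵥ MS.mulVec v := fun v hv => by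
    have := hminS.2 ⟨v, hv, rfl⟩
    rwa [le_div_iff₀ (hdot v hv)] at this
  have hmax : ∀ v : Fin NS → ℝ, v ≠ 0 → v ⬝ᵥ MS.mulVec v ≤ lamMaxS * (v ⬝ᵥ v) := fun v hv => by
    have := hmaxS.2 ⟨v, hv, rfl⟩
    rwa [div_le_iff₀ (hdot v hv)] at this
  have hMR0 : ∀ y : Fin NR → ℝ, 0 ≤ y ⬝ᵥ MR.mulVec y := fun y => by
    by_cases hy : y = 0
    · simp [hy]
    · exact (hMRpos y hy).le
  -- the projection is a contraction
  have hcontr : ∀ y, (y - P y) ⬝ᵥ MR.mulVec (y - P y) ≤ y ⬝ᵥ MR.mulVec y := fun y => by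
    have h1 := hP_orth y (P y) (hP_mem y)
    have h2 : P y ⬝ᵥ MR.mulVec (y - P y) = 0 := by
      rw [dotProduct_mulVec, ← mulVec_transpose, hMRsymm.eq, dotProduct_comm, h1]
    have h3 : y ⬝ᵥ MR.mulVec y =
        ((y - P y) + P y) ⬝ᵥ MR.mulVec ((y - P y) + P y) := by simp
    rw [h3, mulVec_add, add_dotProduct, dotProduct_add, dotProduct_add, h1, h2]
    linarith [hMR0 (P y)]
  set B : (Fin NS → ℝ) → (Fin NR → ℝ) := fun v => T.mulVec v - P (T.mulVec v) with hB
  have hbdd : BddAbove {t : ℝ | ∃ x : Fin NS → ℝ, x ≠ 0 ∧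
      t = matWeightedNorm MR (B x) / matWeightedNorm MS x} := by
    obtain ⟨C, hC0, hC⟩ := quad_bound (Tᵀ * MR * T)
    refine ⟨Real.sqrt (C / lamMinS), ?_⟩
    rintro t ⟨v, hv, rfl⟩
    rw [matWeightedNorm, matWeightedNorm, div_le_iff₀ (Real.sqrt_pos.2 (hMSpos v hv)),
      ← Real.sqrt_mul (by positivity)]
    apply Real.sqrt_le_sqrt
    calc _ ≤ T.mulVec v ⬝ᵥ MR.mulVec (T.mulVec v) := hcontr _
      _ = v ⬝ᵥ (Tᵀ * MR * T).mulVec v := by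
        rw [← mulVec_mulVec, ← mulVec_mulVec, dotProduct_mulVec v, vecMul_transpose]
      _ ≤ C * (v ⬝ᵥ v) := hC v
      _ = C / lamMinS * (lamMinS * (v ⬝ᵥ v)) := by field_simp
      _ ≤ _ := by gcongr; exact hmin v hv
  set nB := matWeightedOpNorm MS MR B with hnB
  have hop : ∀ v, v ≠ 0 → matWeightedNorm MR (B v) ≤ nB * matWeightedNorm MS v := fun v hv => by
    have hpos : 0 < matWeightedNorm MS v := Real.sqrt_pos.2 (hMSpos v hv)
    rw [← div_le_iff₀ hpos]
    exact le_csSup hbdd ⟨v, hv, rfl⟩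
  have hnB0 : 0 ≤ nB := by
    apply Real.sSup_nonneg
    rintro t ⟨v, hv, rfl⟩
    exact div_nonneg (Real.sqrt_nonneg _) (Real.sqrt_nonneg _)
  have hB0 : matWeightedNorm MR (B 0) = 0 := by
    have h := hcontr (T.mulVec 0)
    simp only [matWeightedNorm, hB]
    apply Real.sqrt_eq_zero_of_nonpos
    simpa using h
  have hop2 : ∀ w, matWeightedNorm MR (B w) ≤ nB * Real.sqrt (lamMaxS * (w ⬝ᵥ w)) := fun w => by
    by_cases hw : w = 0
    · rw [hw, hB0]; positivity
    · exact (hop w hw).trans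
        (mul_le_mul_of_nonneg_left (Real.sqrt_le_sqrt (hmax w hw)) hnB0)
  obtain ⟨L, hLm, hLmap, hLw⟩ := gauss_proj T
  have hprob : ∀ n, IsProbabilityMeasure (stdGaussianVec n) := fun n => by
    unfold stdGaussianVec; infer_instance
  set μ := Measure.pi fun _ : Fin nt => stdGaussianVec NS with hμ
  let S : Set (Fin T.rank → ℝ) := {z | 2 * x ≤ ∑ i, (z i) ^ 2}
  have hSm : MeasurableSet S := measurableSet_le (by fun_prop) (by fun_prop)
  have hbad : ∀ i : Fin nt, μ.real {r | L (r i) ∈ S} = ε / nt := fun i => by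
    have h1 : μ {r | L (r i) ∈ S} = stdGaussianVec T.rank S := by
      rw [← hLmap, Measure.map_apply hLm hSm,
        ← (measurePreserving_eval (fun _ : Fin nt => stdGaussianVec NS) i).measure_preimage
          (hLm hSm).nullMeasurableSet]
      rfl
    rw [Measure.real, h1]
    exact hxdef
  let bad : Set (Fin nt → Fin NS → ℝ) := ⋃ i, {r | L (r i) ∈ S}
  have hbadm : MeasurableSet bad := MeasurableSet.iUnion fun i =>
    (hLm.comp (measurable_pi_apply i)) hSm
  have hbadle : μ.real bad ≤ ε := by
    refine (measureReal_iUnion_fintype_le _).trans ?_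
    simp only [hbad, Finset.sum_const, Finset.card_univ, Fintype.card_fin, nsmul_eq_mul]
    have : (0 : ℝ) < nt := by exact_mod_cast hnt
    rw [mul_div_cancel₀ _ this.ne']
  have hgood : 1 - ε ≤ μ.real badᶜ := by
    rw [probReal_compl_eq_one_sub hbadm]; linarith
  refine hgood.trans (measureReal_mono ?_)
  intro r hr
  simp only [bad, S, Set.mem_compl_iff, Set.mem_iUnion, Set.mem_ofPred_eq, not_exists, not_le] at hr
  have hsup : (⨆ i : Fin nt, matWeightedNorm MR (B (r i))) ≤
      nB * Real.sqrt (lamMaxS * (2 * x)) := by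
    apply ciSup_le
    intro i
    obtain ⟨w, hw1, hw2⟩ := hLw (r i)
    have : B (r i) = B w := by simp only [hB, hw1]
    rw [this]
    refine (hop2 w).trans ?_
    rw [hw2]
    gcongr
    exact (hr i).le
  change (Real.sqrt (2 * lamMinS) * s)⁻¹ * (⨆ i : Fin nt, matWeightedNorm MR (B (r i))) ≤ _
  have hid : (Real.sqrt (2 * lamMinS) * s)⁻¹ * Real.sqrt (lamMaxS * (2 * x)) =
      Real.sqrt (x * (lamMaxS / lamMinS) * (s ^ 2)⁻¹) := by
    symm
    rw [Real.sqrt_eq_iff_mul_self_eq (by positivity) (by positivity)]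
    symm
    have e1 := Real.mul_self_sqrt (show 0 ≤ 2 * lamMinS by positivity)
    have e2 := Real.mul_self_sqrt (show 0 ≤ lamMaxS * (2 * x) by positivity)
    calc _ = (Real.sqrt (lamMaxS * (2 * x)) * Real.sqrt (lamMaxS * (2 * x))) *
          (Real.sqrt (2 * lamMinS) * Real.sqrt (2 * lamMinS))⁻¹ * (s ^ 2)⁻¹ := by
            simp only [mul_inv]; ring
      _ = _ := by rw [e1, e2]; field_simp
  calc _ ≤ (Real.sqrt (2 * lamMinS) * s)⁻¹ * (nB * Real.sqrt (lamMaxS * (2 * x))) := by gcongr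
    _ = ((Real.sqrt (2 * lamMinS) * s)⁻¹ * Real.sqrt (lamMaxS * (2 * x))) * nB := by ring
    _ = _ := by rw [hid]
end
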